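/- For any prime number p, the cardinality of 𝓑₊(p) satisfies |#𝓑₊(p) − p/24| ≤ 12 · p^{3/4} · log p, where log denotes the natural logarithm. -/

import Mathlib

/-- The inverse of `b` modulo `p`, normalized to lie in `[0, p-1]`. -/
def modInv (p b : ℕ) : ℕ := ((b : ZMod p)⁻¹).val

/-- The set `𝓑₊(p)` of integers `β` with `1 ≤ β ≤ (p-3)/2`, `β + β̄ ≥ p` and `β̄ ≤ 2β`. -/
def Bplus (p : ℕ) : Finset ℕ :=
  (Finset.Icc 1 p).filter fun β =>
    2 * β + 3 ≤ p ∧ p ≤ β + modInv p β ∧ modInv p β ≤ 2 * β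

open Finset

section
variable {p : ℕ} [NeZero p]
local notation "𝐞" => (ZMod.stdAddChar : AddChar (ZMod p) ℂ)

/-- The distance from `k` to `0` in the cyclic group `ZMod p`. -/
def dz (k : ZMod p) : ℕ := min k.val (p - k.val)

lemma dz_pos {k : ZMod p} (hk : k ≠ 0) : 0 < dz k := by
  have h1 := ZMod.val_lt k
  have h2 := ZMod.val_pos.2 hk
  unfold dz; omega

lemma four_mul_dz_le (k : ZMod p) : 4 * (dz k : ℝ) / p ≤ ‖𝐞 k - 1‖ := by
  have hp : (0 : ℝ) < p := by exact_mod_cast NeZero.pos p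
  have hv : (k.val : ℝ) < p := by exact_mod_cast ZMod.val_lt k
  have he : 𝐞 k = Complex.exp (Complex.I * ((2 * (Real.pi * k.val / p) : ℝ) : ℂ)) := by
    rw [ZMod.stdAddChar_apply, ZMod.toCircle_apply]
    congr 1
    push_cast
    ring
  rw [he, Complex.norm_exp_I_mul_ofReal_sub_one, mul_div_cancel_left₀ _ two_ne_zero, norm_mul,
    Real.norm_two, Real.norm_eq_abs]
  have hd1 : (dz k : ℝ) ≤ k.val := by exact_mod_cast min_le_left _ _
  have hd2 : (dz k : ℝ) ≤ p - k.val := by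
    rw [← Nat.cast_sub (ZMod.val_lt k).le]; exact_mod_cast min_le_right _ _
  have key : 2 * (dz k : ℝ) / p ≤ Real.sin (Real.pi * k.val / p) := by
    have hpi := Real.pi_pos
    rcases le_total (2 * (k.val : ℝ)) p with h | h
    · have := Real.mul_le_sin (x := Real.pi * k.val / p) (by positivity) (by
        rw [div_le_div_iff₀ hp two_pos]; nlinarith)
      refine le_trans ?_ this
      rw [show 2 / Real.pi * (Real.pi * k.val / p) = 2 * k.val / p by field_simp]
      gcongr
    · have := Real.mul_le_sin (x := Real.pi * (p - k.val) / p)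
        (div_nonneg (mul_nonneg hpi.le (by linarith)) hp.le) (by
        rw [div_le_div_iff₀ hp two_pos]; nlinarith)
      rw [show Real.pi * (p - k.val) / p = Real.pi - Real.pi * k.val / p by field_simp,
        Real.sin_pi_sub] at this
      refine le_trans ?_ this
      rw [show 2 / Real.pi * (Real.pi - Real.pi * k.val / p) = 2 * (p - k.val) / p by field_simp]
      gcongr
  have := le_abs_self (Real.sin (Real.pi * k.val / p))
  calc 4 * (dz k : ℝ) / p = 2 * (2 * (dz k : ℝ) / p) := by ring
    _ ≤ _ := by linarith

lemma inv_norm_sub_one_le {k : ZMod p} (hk : k ≠ 0) : ‖𝐞 k - 1‖⁻¹ ≤ p / (4 * dz k) := by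
  have hp : (0 : ℝ) < p := by exact_mod_cast NeZero.pos p
  have hd : (0 : ℝ) < dz k := by exact_mod_cast dz_pos hk
  rw [← inv_div]
  exact inv_anti₀ (by positivity) (four_mul_dz_le k)

lemma sum_dz_le (f : ℕ → ℝ) (hf : ∀ n, 0 ≤ f n) :
    ∑ k : ZMod p with k ≠ 0, f (dz k) ≤ 2 * ∑ j ∈ Ico 1 p, f j := by
  have h1 : ∑ k : ZMod p with k ≠ 0, f k.val = ∑ j ∈ Ico 1 p, f j := by
    refine sum_bij' (fun k _ => k.val) (fun j _ => (j : ZMod p)) ?_ ?_ ?_ ?_ ?_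
    · intro k hk
      have := ZMod.val_pos.2 (mem_filter.1 hk).2
      exact mem_Ico.2 ⟨this, ZMod.val_lt k⟩
    · intro j hj
      rw [mem_Ico] at hj
      simp only [mem_filter, mem_univ, true_and]
      intro h
      have := congrArg ZMod.val h
      rw [ZMod.val_natCast_of_lt hj.2, ZMod.val_zero] at this
      omega
    · intro k _; simp
    · intro j hj; exact ZMod.val_natCast_of_lt (mem_Ico.1 hj).2
    · intro k _; rfl
  have h2 : ∑ k : ZMod p with k ≠ 0, f (-k).val = ∑ k : ZMod p with k ≠ 0, f k.val :=
    sum_bij' (fun k _ => -k) (fun k _ => -k) (by simp) (by simp) (by simp) (by simp) (by simp)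
  calc ∑ k : ZMod p with k ≠ 0, f (dz k)
      ≤ ∑ k : ZMod p with k ≠ 0, (f k.val + f (-k).val) := by
        refine sum_le_sum fun k hk => ?_
        have hk0 : k ≠ 0 := (mem_filter.1 hk).2
        have : NeZero k := ⟨hk0⟩
        rw [ZMod.val_neg_of_ne_zero]
        rcases min_choice k.val (p - k.val) with h | h
        · rw [dz, h]; linarith [hf (p - k.val)]
        · rw [dz, h]; linarith [hf k.val]
    _ = _ := by rw [sum_add_distrib, h2, h1]; ring

lemma sum_mul_stdAddChar (a : ZMod p) : ∑ h : ZMod p, 𝐞 (h * a) = if a = 0 then (p : ℂ) else 0 := by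
  rw [AddChar.sum_mulShift a (ZMod.isPrimitive_stdAddChar p), ZMod.card]
  split_ifs <;> simp

lemma stdAddChar_mul_natCast (k : ZMod p) (n : ℕ) : 𝐞 (k * n) = 𝐞 k ^ n := by
  rw [← AddChar.map_nsmul_eq_pow, nsmul_eq_mul, mul_comm]

lemma norm_sum_Ico_stdAddChar_le {k : ZMod p} (hk : k ≠ 0) {a b : ℕ} (hab : a ≤ b) :
    ‖∑ x ∈ Ico a b, 𝐞 (k * x)‖ ≤ p / (2 * dz k) := by
  have h1 : 𝐞 k ≠ 1 := fun h => hk (ZMod.injective_stdAddChar (by rw [h, AddChar.map_zero_eq_one]))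
  simp_rw [stdAddChar_mul_natCast]
  rw [geom_sum_Ico h1 hab, norm_div, div_eq_mul_inv]
  have h2 : ‖𝐞 k ^ b - 𝐞 k ^ a‖ ≤ 2 := by
    refine (norm_sub_le _ _).trans ?_
    rw [norm_pow, norm_pow, AddChar.norm_apply]; norm_num
  calc _ ≤ 2 * (p / (4 * dz k) : ℝ) := by
        gcongr
        exact inv_norm_sub_one_le hk
    _ = _ := by ring

lemma sum_zmod_eq_sum_range (f : ZMod p → ℂ) : ∑ y, f y = ∑ j ∈ range p, f (j : ZMod p) :=
  sum_bij' (fun k _ => k.val) (fun j _ => (j : ZMod p)) (by simp [ZMod.val_lt]) (by simp) (by simp)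
    (fun j hj => ZMod.val_natCast_of_lt (mem_range.1 hj)) (by simp)

lemma sum_range_mul_pow_mul (z : ℂ) (n : ℕ) :
    (∑ j ∈ range n, (j : ℂ) * z ^ j) * (z - 1) = n * z ^ n - z * ∑ j ∈ range n, z ^ j := by
  induction n with
  | zero => simp
  | succ n ih => rw [sum_range_succ, add_mul, ih, sum_range_succ]; push_cast; ring

lemma sum_val_mul_stdAddChar {k : ZMod p} (hk : k ≠ 0) :
    ∑ y : ZMod p, (y.val : ℂ) * 𝐞 (k * y) = p / (𝐞 k - 1) := by
  have h1 : 𝐞 k ≠ 1 := fun h => hk (ZMod.injective_stdAddChar (by rw [h, AddChar.map_zero_eq_one]))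
  have h2 : 𝐞 k - 1 ≠ 0 := sub_ne_zero.2 h1
  have h3 : 𝐞 k ^ p = 1 := by rw [← stdAddChar_mul_natCast]; simp
  rw [sum_zmod_eq_sum_range, eq_div_iff h2]
  have : ∑ j ∈ range p, (((j : ZMod p).val : ℕ) : ℂ) * 𝐞 (k * j)
      = ∑ j ∈ range p, (j : ℂ) * 𝐞 k ^ j := by
    refine sum_congr rfl fun j hj => ?_
    rw [ZMod.val_natCast_of_lt (mem_range.1 hj), stdAddChar_mul_natCast]
  rw [this, sum_range_mul_pow_mul, geom_sum_eq h1, h3]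
  simp

lemma val_sub_eq_sum (y : ZMod p) :
    (y.val : ℂ) - (p - 1) / 2 = ∑ h : ZMod p with h ≠ 0, 𝐞 (h * y) / (𝐞 (-h) - 1) := by
  have hp : (p : ℂ) ≠ 0 := by exact_mod_cast NeZero.ne p
  have h1 : ∑ h : ZMod p, ∑ t : ZMod p, (t.val : ℂ) * 𝐞 (h * (y - t)) = p * y.val := by
    rw [sum_comm]
    simp_rw [← mul_sum, sum_mul_stdAddChar, sub_eq_zero]
    simp [mul_comm]
  have h2 : ∑ t : ZMod p, (t.val : ℂ) = p * ((p - 1) / 2) := by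
    rw [sum_zmod_eq_sum_range]
    have : ∑ j ∈ range p, (((j : ZMod p).val : ℕ) : ℂ) = ((∑ j ∈ range p, j : ℕ) : ℂ) := by
      push_cast
      exact sum_congr rfl fun j hj => by rw [ZMod.val_natCast_of_lt (mem_range.1 hj)]
    have h3 := congrArg (Nat.cast : ℕ → ℂ) (Finset.sum_range_id_mul_two p)
    rw [Nat.cast_mul, Nat.cast_mul, Nat.cast_sub (NeZero.pos p)] at h3
    rw [this]
    push_cast at h3 ⊢
    linear_combination h3 / 2
  rw [← sum_filter_add_sum_filter_not univ (fun h : ZMod p => h ≠ 0)] at h1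
  have h3 : (univ.filter fun h : ZMod p => ¬ h ≠ 0) = {0} := by ext; simp
  rw [h3, sum_singleton] at h1
  simp only [zero_mul, AddChar.map_zero_eq_one, mul_one, h2] at h1
  have h4 : ∀ h ∈ univ.filter (fun h : ZMod p => h ≠ 0),
      ∑ t : ZMod p, (t.val : ℂ) * 𝐞 (h * (y - t)) = p * (𝐞 (h * y) / (𝐞 (-h) - 1)) := by
    intro h hh
    have h5 : (-h : ZMod p) ≠ 0 := neg_ne_zero.2 (mem_filter.1 hh).2
    rw [mul_div_left_comm, ← sum_val_mul_stdAddChar h5, mul_sum]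
    refine sum_congr rfl fun t _ => ?_
    rw [mul_left_comm, ← AddChar.map_add_eq_mul]
    congr 2; ring
  rw [sum_congr rfl h4, ← mul_sum] at h1
  refine mul_left_cancel₀ hp ?_
  linear_combination -h1

lemma sum_norm_sq_eq {ι : Type*} (s : Finset ι) (a b : ι → ZMod p) :
    ∑ k : ZMod p, ∑ h : ZMod p, ‖∑ q ∈ s, 𝐞 (k * a q + h * b q)‖ ^ 2
      = p ^ 2 * (#{x ∈ s ×ˢ s | a x.1 = a x.2 ∧ b x.1 = b x.2} : ℝ) := by
  have hc (x : ZMod p) : starRingEnd ℂ (𝐞 x) = 𝐞 (-x) := (AddChar.map_neg_eq_conj _ _).symm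
  have h1 (k h : ZMod p) : ((‖∑ q ∈ s, 𝐞 (k * a q + h * b q)‖ ^ 2 : ℝ) : ℂ)
      = ∑ x ∈ s ×ˢ s, 𝐞 (k * (a x.1 - a x.2)) * 𝐞 (h * (b x.1 - b x.2)) := by
    rw [Complex.ofReal_pow, ← Complex.mul_conj', map_sum, sum_mul_sum, sum_product]
    refine sum_congr rfl fun x _ => sum_congr rfl fun y _ => ?_
    rw [hc, ← AddChar.map_add_eq_mul, ← AddChar.map_add_eq_mul]
    congr 1; ring
  have h2 : ∑ k : ZMod p, ∑ h : ZMod p, ∑ x ∈ s ×ˢ s,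
      𝐞 (k * (a x.1 - a x.2)) * 𝐞 (h * (b x.1 - b x.2))
      = ∑ x ∈ s ×ˢ s, if a x.1 = a x.2 ∧ b x.1 = b x.2 then (p : ℂ) ^ 2 else 0 := by
    calc _ = ∑ k : ZMod p, ∑ x ∈ s ×ˢ s, ∑ h : ZMod p,
          𝐞 (k * (a x.1 - a x.2)) * 𝐞 (h * (b x.1 - b x.2)) :=
          sum_congr rfl fun _ _ => sum_comm
      _ = _ := by
          rw [sum_comm]
          refine sum_congr rfl fun x _ => ?_
          rw [← sum_mul_sum, sum_mul_stdAddChar, sum_mul_stdAddChar]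
          simp only [sub_eq_zero]
          split_ifs <;> simp_all [sq]
  rw [← Complex.ofReal_inj]
  push_cast
  rw [← sum_filter, sum_const, nsmul_eq_mul] at h2
  rw [mul_comm, ← h2]
  exact sum_congr rfl fun k _ => sum_congr rfl fun h _ => by rw [← h1]; push_cast; rfl

end

section
variable {p : ℕ} [Fact p.Prime]
local notation "𝐞" => (ZMod.stdAddChar : AddChar (ZMod p) ℂ)

/-- The Kloosterman sum `∑ e((k x + h x⁻¹) / p)` over the nonzero residues `x` modulo `p`. -/
noncomputable def kloosterman (k h : ZMod p) : ℂ :=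
  ∑ x : ZMod p with x ≠ 0, 𝐞 (k * x + h * x⁻¹)

lemma kloosterman_eq_mul_one (k : ZMod p) {h : ZMod p} (hh : h ≠ 0) :
    kloosterman k h = kloosterman (k * h) 1 := by
  refine sum_bij' (fun x _ => h⁻¹ * x) (fun x _ => h * x) ?_ ?_ ?_ ?_ ?_
  · intro x hx; simpa [hh] using hx
  · intro x hx; simpa [hh] using hx
  · intro x _; field_simp
  · intro x _; field_simp
  · intro x _
    congr 1
    rw [mul_inv, inv_inv]
    field_simp

lemma sum_kloosterman_eq {h : ZMod p} (hh : h ≠ 0) :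
    ∑ k : ZMod p, ‖kloosterman k h‖ ^ 4 = ∑ k : ZMod p, ‖kloosterman k 1‖ ^ 4 := by
  simp_rw [kloosterman_eq_mul_one _ hh]
  exact Equiv.sum_comp (Equiv.mulRight₀ h hh) fun k => ‖kloosterman k 1‖ ^ 4

lemma card_nonzero : #{x : ZMod p | x ≠ 0} = p - 1 := by
  rw [filter_ne', card_erase_of_mem (mem_univ _), card_univ, ZMod.card]

lemma eq_or_eq_or_eq_of_add_eq_add {K : Type*} [Field K] {a b c d : K} (ha : a ≠ 0) (hb : b ≠ 0)
    (hc : c ≠ 0) (hd : d ≠ 0) (h1 : a + b = c + d) (h2 : a⁻¹ + b⁻¹ = c⁻¹ + d⁻¹) :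
    (c = a ∧ d = b) ∨ (c = b ∧ d = a) ∨ (b = -a ∧ d = -c) := by
  by_cases hs : a + b = 0
  · exact .inr (.inr ⟨by linear_combination hs, by linear_combination hs - h1⟩)
  · have h3 : (a + b) * (c * d - a * b) = 0 := by
      field_simp at h2
      linear_combination h2 - (a * b) * h1
    have h4 : c * d = a * b := sub_eq_zero.1 ((mul_eq_zero.1 h3).resolve_left hs)
    have h5 : (c - a) * (c - b) = 0 := by linear_combination -c * h1 - h4
    rcases mul_eq_zero.1 h5 with h | h
    · exact .inl ⟨by linear_combination h, by linear_combination -h1 - h⟩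
    · exact .inr (.inl ⟨by linear_combination h, by linear_combination -h1 - h⟩)

lemma card_quadruples_le (T : Finset (ZMod p)) (hT : ∀ x ∈ T, x ≠ 0) :
    #{x ∈ (T ×ˢ T) ×ˢ (T ×ˢ T) | x.1.1 + x.1.2 = x.2.1 + x.2.2 ∧
      x.1.1⁻¹ + x.1.2⁻¹ = x.2.1⁻¹ + x.2.2⁻¹} ≤ 3 * #T ^ 2 := by
  have hsub : {x ∈ (T ×ˢ T) ×ˢ (T ×ˢ T) | x.1.1 + x.1.2 = x.2.1 + x.2.2 ∧
      x.1.1⁻¹ + x.1.2⁻¹ = x.2.1⁻¹ + x.2.2⁻¹} ⊆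
      ((T ×ˢ T).image (fun q => ((q.1, q.2), (q.1, q.2))) ∪
        (T ×ˢ T).image (fun q => ((q.1, q.2), (q.2, q.1)))) ∪
        (T ×ˢ T).image (fun q => ((q.1, -q.1), (q.2, -q.2))) := by
    rintro ⟨⟨a, b⟩, ⟨c, d⟩⟩ hx
    simp only [mem_filter, mem_product] at hx
    obtain ⟨⟨⟨ha, hb⟩, hc, hd⟩, h1, h2⟩ := hx
    simp only [mem_union, mem_image, mem_product, Prod.exists, Prod.mk.injEq]
    rcases eq_or_eq_or_eq_of_add_eq_add (hT a ha) (hT b hb) (hT c hc) (hT d hd) h1 h2 with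
      ⟨rfl, rfl⟩ | ⟨rfl, rfl⟩ | ⟨rfl, rfl⟩
    · exact .inl (.inl ⟨_, _, ⟨ha, hb⟩, ⟨rfl, rfl⟩, rfl, rfl⟩)
    · exact .inl (.inr ⟨_, _, ⟨ha, hb⟩, ⟨rfl, rfl⟩, rfl, rfl⟩)
    · exact .inr ⟨_, _, ⟨ha, hc⟩, ⟨rfl, rfl⟩, rfl, rfl⟩
  have hT2 : #(T ×ˢ T) = #T ^ 2 := by rw [card_product, sq]
  refine (card_le_card hsub).trans ((card_union_le _ _).trans ?_)
  have h1 := card_union_le ((T ×ˢ T).image (fun q => ((q.1, q.2), (q.1, q.2))))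
    ((T ×ˢ T).image (fun q => ((q.1, q.2), (q.2, q.1))))
  have h2 := card_image_le (s := T ×ˢ T) (f := fun q => ((q.1, q.2), (q.1, q.2)))
  have h3 := card_image_le (s := T ×ˢ T) (f := fun q => ((q.1, q.2), (q.2, q.1)))
  have h4 := card_image_le (s := T ×ˢ T) (f := fun q => ((q.1, -q.1), (q.2, -q.2)))
  omega

/-- The fourth moment bound for Kloosterman sums. -/
lemma sum_norm_kloosterman_pow_four_le {h : ZMod p} (hh : h ≠ 0) :
    ∑ k : ZMod p, ‖kloosterman k h‖ ^ 4 ≤ 3 * (p : ℝ) ^ 3 := by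
  set T : Finset (ZMod p) := {x | x ≠ 0} with hTdef
  have hp1 : (1 : ℝ) < p := by exact_mod_cast (Fact.out : p.Prime).one_lt
  have hT : (#T : ℝ) = p - 1 := by
    rw [hTdef, card_nonzero, Nat.cast_sub (NeZero.pos p), Nat.cast_one]
  have h1 (k h : ZMod p) : ‖kloosterman k h‖ ^ 4
      = ‖∑ q ∈ T ×ˢ T, 𝐞 (k * (q.1 + q.2) + h * (q.1⁻¹ + q.2⁻¹))‖ ^ 2 := by
    rw [show 4 = 2 * 2 from rfl, pow_mul, ← norm_pow, sq (kloosterman k h), kloosterman,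
      sum_mul_sum, sum_product]
    congr 2
    refine sum_congr rfl fun x _ => sum_congr rfl fun y _ => ?_
    rw [← AddChar.map_add_eq_mul]
    congr 1; ring
  have h2 : ∑ k : ZMod p, ∑ h : ZMod p, ‖kloosterman k h‖ ^ 4
      ≤ p ^ 2 * (3 * (p - 1 : ℝ) ^ 2) := by
    simp_rw [h1]
    rw [sum_norm_sq_eq, ← hT]
    gcongr
    exact_mod_cast card_quadruples_le T (by simp [hTdef])
  have h3 : (p - 1 : ℝ) * ∑ k : ZMod p, ‖kloosterman k 1‖ ^ 4
      ≤ ∑ k : ZMod p, ∑ h : ZMod p, ‖kloosterman k h‖ ^ 4 := by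
    rw [sum_comm, ← hT, ← nsmul_eq_mul, ← sum_const]
    rw [← sum_congr rfl fun h (hmem : h ∈ T) => sum_kloosterman_eq (mem_filter.1 hmem).2]
    exact sum_le_sum_of_subset_of_nonneg (subset_univ _) fun _ _ _ => by positivity
  rw [sum_kloosterman_eq hh]
  have h4 : (p - 1 : ℝ) * ∑ k : ZMod p, ‖kloosterman k 1‖ ^ 4
      ≤ (p - 1) * (3 * p ^ 2 * (p - 1)) := by
    refine (h3.trans h2).trans (le_of_eq (by ring))
  have h5 := le_of_mul_le_mul_left h4 (by linarith)
  nlinarith [sq_nonneg (p : ℝ)]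

lemma rpow_add_one_le_sub {x : ℝ} (hx : 0 < x) :
    (x + 1) ^ (-(4 : ℝ) / 3) ≤ 3 * (x ^ (-(1 : ℝ) / 3) - (x + 1) ^ (-(1 : ℝ) / 3)) := by
  have hx1 : 0 < x + 1 := by linarith
  set a := x ^ ((1 : ℝ) / 3) with ha
  set b := (x + 1) ^ ((1 : ℝ) / 3) with hb
  have ha0 : 0 < a := by positivity
  have hb0 : 0 < b := by positivity
  have hab : a ≤ b := Real.rpow_le_rpow hx.le (by linarith) (by norm_num)
  have ha3 : a ^ 3 = x := by rw [ha, ← Real.rpow_natCast, ← Real.rpow_mul hx.le]; norm_num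
  have hb3 : b ^ 3 = x + 1 := by rw [hb, ← Real.rpow_natCast, ← Real.rpow_mul hx1.le]; norm_num
  have h1 : x ^ (-(1 : ℝ) / 3) = a⁻¹ := by rw [neg_div, Real.rpow_neg hx.le]
  have h2 : (x + 1) ^ (-(1 : ℝ) / 3) = b⁻¹ := by rw [neg_div, Real.rpow_neg hx1.le]
  have h3 : (x + 1) ^ (-(4 : ℝ) / 3) = (b ^ 4)⁻¹ := by
    rw [neg_div, Real.rpow_neg hx1.le, hb, ← Real.rpow_natCast, ← Real.rpow_mul hx1.le]
    norm_num
  have h4 : a ≤ 3 * b ^ 3 * (b - a) := by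
    have h5 : b * ((b - a) * (a ^ 2 + a * b + b ^ 2)) = b := by linear_combination b * (hb3 - ha3)
    have h6 : a ^ 2 + a * b + b ^ 2 ≤ 3 * b ^ 2 := by nlinarith
    have h7 := mul_le_mul_of_nonneg_left h6 (mul_nonneg hb0.le (sub_nonneg.2 hab))
    linarith
  rw [h1, h2, h3, inv_sub_inv ha0.ne' hb0.ne', inv_eq_one_div, ← mul_div_assoc,
    div_le_div_iff₀ (by positivity) (by positivity)]
  nlinarith

lemma sum_rpow_le (n : ℕ) : ∑ j ∈ Ico 1 n, (j : ℝ) ^ (-(4 : ℝ) / 3) ≤ 4 := by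
  suffices h : ∀ n : ℕ, ∑ j ∈ Ico 1 (n + 1), (j : ℝ) ^ (-(4 : ℝ) / 3)
      ≤ 4 - 3 * (n : ℝ) ^ (-(1 : ℝ) / 3) ∨ n = 0 by
    rcases n with _ | n
    · simp
    · rcases h n with h | rfl
      · exact h.trans (by linarith [Real.rpow_nonneg (Nat.cast_nonneg (α := ℝ) n) (-(1 : ℝ) / 3)])
      · simp
  intro n
  rcases n with _ | n
  · exact .inr rfl
  left
  induction n with
  | zero => norm_num
  | succ n ih =>
    rw [sum_Ico_succ_top (by omega)]
    set x : ℝ := ((n + 1 : ℕ) : ℝ) with hx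
    have hx1 : 1 ≤ x := by rw [hx]; push_cast; linarith [Nat.cast_nonneg (α := ℝ) n]
    have hxs : ((n + 1 + 1 : ℕ) : ℝ) = x + 1 := by rw [hx]; push_cast; ring
    rw [hxs]
    suffices h : (x + 1) ^ (-(4 : ℝ) / 3) ≤ 3 * (x ^ (-(1 : ℝ) / 3) - (x + 1) ^ (-(1 : ℝ) / 3)) by
      linarith
    exact rpow_add_one_le_sub (by linarith)

lemma sum_rpow_norm_le {I : ZMod p → ℂ} (h0 : ‖I 0‖ ≤ p)
    (hI : ∀ k ≠ 0, ‖I k‖ ≤ p / (2 * dz k)) :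
    ∑ k : ZMod p, ‖I k‖ ^ ((4 : ℝ) / 3) ≤ 5 * (p : ℝ) ^ ((4 : ℝ) / 3) := by
  rw [← sum_filter_add_sum_filter_not univ (fun h : ZMod p => h ≠ 0)]
  have h3 : (univ.filter fun h : ZMod p => ¬ h ≠ 0) = {0} := by ext; simp
  rw [h3, sum_singleton]
  have h4 : ‖I 0‖ ^ ((4 : ℝ) / 3) ≤ (p : ℝ) ^ ((4 : ℝ) / 3) := by gcongr
  have h5 : ∑ k : ZMod p with k ≠ 0, ‖I k‖ ^ ((4 : ℝ) / 3)
      ≤ ∑ k : ZMod p with k ≠ 0, (p : ℝ) ^ ((4 : ℝ) / 3) / 2 * (dz k : ℝ) ^ (-(4 : ℝ) / 3) := by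
    refine sum_le_sum fun k hk => ?_
    have hk0 : k ≠ 0 := (mem_filter.1 hk).2
    calc ‖I k‖ ^ ((4 : ℝ) / 3) ≤ (p / (2 * dz k) : ℝ) ^ ((4 : ℝ) / 3) := by
          gcongr; exact hI k hk0
      _ = (p : ℝ) ^ ((4 : ℝ) / 3) / 2 ^ ((4 : ℝ) / 3) * (dz k : ℝ) ^ (-(4 : ℝ) / 3) := by
          rw [Real.div_rpow (by positivity) (by positivity),
            Real.mul_rpow (by positivity) (by positivity), neg_div,
            Real.rpow_neg (by positivity)]
          field_simp
      _ ≤ _ := by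
          gcongr
          exact Real.self_le_rpow_of_one_le (by norm_num) (by norm_num)
  rw [← mul_sum] at h5
  have h6 := sum_dz_le (p := p) (fun n => (n : ℝ) ^ (-(4 : ℝ) / 3)) (fun n => by positivity)
  have h7 := sum_rpow_le p
  have h8 : (0 : ℝ) ≤ (p : ℝ) ^ ((4 : ℝ) / 3) := by positivity
  nlinarith

lemma sum_incomplete_eq (u h : ZMod p) {a b : ℕ} (ha : 1 ≤ a) (hb : b ≤ p) :
    p * ∑ x ∈ Ico a b, 𝐞 (u * x + h * (x : ZMod p)⁻¹)
      = ∑ k : ZMod p, (∑ t ∈ Ico a b, 𝐞 (-k * t)) * kloosterman (k + u) h := by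
  have h1 (k : ZMod p) : (∑ t ∈ Ico a b, 𝐞 (-k * t)) * kloosterman (k + u) h
      = ∑ t ∈ Ico a b, ∑ x : ZMod p with x ≠ 0, 𝐞 (u * x + h * x⁻¹) * 𝐞 (k * (x - t)) := by
    rw [kloosterman, sum_mul_sum]
    refine sum_congr rfl fun t _ => sum_congr rfl fun x _ => ?_
    rw [← AddChar.map_add_eq_mul, ← AddChar.map_add_eq_mul]
    congr 1; ring
  simp_rw [h1]
  rw [sum_comm, mul_sum]
  refine sum_congr rfl fun t ht => ?_
  rw [sum_comm]
  simp_rw [← mul_sum, sum_mul_stdAddChar, sub_eq_zero]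
  have ht0 : (t : ZMod p) ≠ 0 := by
    rw [mem_Ico] at ht
    rw [Ne, ZMod.natCast_eq_zero_iff]
    exact Nat.not_dvd_of_pos_of_lt (by omega) (by omega)
  simp [ht0, mul_comm]

lemma norm_incomplete_le (u : ZMod p) {h : ZMod p} (hh : h ≠ 0) {a b : ℕ} (ha : 1 ≤ a)
    (hab : a ≤ b) (hb : b ≤ p) :
    ‖∑ x ∈ Ico a b, 𝐞 (u * x + h * (x : ZMod p)⁻¹)‖ ≤ 5 * (p : ℝ) ^ ((3 : ℝ) / 4) := by
  have hp : (0 : ℝ) < p := by exact_mod_cast NeZero.pos p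
  set I : ZMod p → ℂ := fun k => ∑ t ∈ Ico a b, 𝐞 (-k * t)
  have hd (k : ZMod p) (hk : k ≠ 0) : dz (-k) = dz k := by
    have : NeZero k := ⟨hk⟩
    have := ZMod.val_lt k
    rw [dz, dz, ZMod.val_neg_of_ne_zero]
    omega
  have hI : ∑ k : ZMod p, ‖I k‖ ^ ((4 : ℝ) / 3) ≤ 5 * (p : ℝ) ^ ((4 : ℝ) / 3) := by
    refine sum_rpow_norm_le ?_ fun k hk => ?_
    · refine (norm_sum_le _ _).trans ?_
      simp only [AddChar.norm_apply, sum_const, Nat.card_Ico, nsmul_eq_mul, mul_one]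
      exact_mod_cast (Nat.sub_le b a).trans hb
    · rw [← hd k hk]
      exact norm_sum_Ico_stdAddChar_le (neg_ne_zero.2 hk) hab
  have hK : ∑ k : ZMod p, ‖kloosterman (k + u) h‖ ^ (4 : ℝ) ≤ 3 * (p : ℝ) ^ 3 := by
    have := Equiv.sum_comp (Equiv.addRight u) fun k => ‖kloosterman k h‖ ^ 4
    simp only [Equiv.coe_addRight] at this
    have h4 (z : ℝ) : z ^ (4 : ℝ) = z ^ 4 := by norm_cast
    simp_rw [h4, this]
    exact sum_norm_kloosterman_pow_four_le hh
  have hconj : Real.HolderConjugate (4 / 3) 4 := by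
    rw [Real.holderConjugate_iff]; norm_num
  have hH := Real.inner_le_Lp_mul_Lq_of_nonneg univ hconj (f := fun k => ‖I k‖)
    (g := fun k => ‖kloosterman (k + u) h‖) (fun _ _ => norm_nonneg _) (fun _ _ => norm_nonneg _)
  have h1 : p * ‖∑ x ∈ Ico a b, 𝐞 (u * x + h * (x : ZMod p)⁻¹)‖
      ≤ ∑ k : ZMod p, ‖I k‖ * ‖kloosterman (k + u) h‖ := by
    rw [← Complex.norm_natCast p, ← norm_mul, sum_incomplete_eq u h ha hb]
    refine (norm_sum_le _ _).trans (le_of_eq ?_)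
    exact sum_congr rfl fun k _ => norm_mul _ _
  refine le_of_mul_le_mul_left (h1.trans (hH.trans ?_)) hp
  calc _ ≤ (5 * (p : ℝ) ^ ((4 : ℝ) / 3)) ^ ((1 : ℝ) / (4 / 3))
        * (5 * (p : ℝ) ^ 3) ^ ((1 : ℝ) / 4) := by
        gcongr
        refine hK.trans ?_
        gcongr; norm_num
    _ = (5 : ℝ) ^ ((1 : ℝ) / (4 / 3)) * 5 ^ ((1 : ℝ) / 4)
        * ((p : ℝ) ^ (((4 : ℝ) / 3) * (1 / (4 / 3))) * (p : ℝ) ^ ((3 : ℝ) * (1 / 4))) := by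
        rw [Real.mul_rpow (by positivity) (by positivity),
          Real.mul_rpow (by positivity) (by positivity), ← Real.rpow_mul hp.le,
          ← Real.rpow_natCast, ← Real.rpow_mul hp.le]
        push_cast
        ring
    _ = p * (5 * (p : ℝ) ^ ((3 : ℝ) / 4)) := by
        rw [← Real.rpow_add (by norm_num)]
        norm_num
        ring

/-- Equidistribution of `u x + v x⁻¹` modulo `p`, tested against the centred sawtooth function. -/
lemma abs_sum_val_sub_le (u v : ZMod p) (hv : v ≠ 0) {a b : ℕ} (ha : 1 ≤ a)
    (hab : a ≤ b) (hb : b ≤ p) :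
    |∑ x ∈ Ico a b, (((u * x + v * (x : ZMod p)⁻¹ : ZMod p).val : ℝ) - (p - 1) / 2)|
      ≤ p * (5 / 2 * (p : ℝ) ^ ((3 : ℝ) / 4) * (1 + Real.log p)) := by
  have hp : (0 : ℝ) < p := by exact_mod_cast NeZero.pos p
  have h1 : ((∑ x ∈ Ico a b,
      (((u * x + v * (x : ZMod p)⁻¹ : ZMod p).val : ℝ) - (p - 1) / 2) : ℝ) : ℂ)
      = ∑ h : ZMod p with h ≠ 0, (𝐞 (-h) - 1)⁻¹ *
        ∑ x ∈ Ico a b, 𝐞 (h * u * x + h * v * (x : ZMod p)⁻¹) := by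
    push_cast
    simp_rw [val_sub_eq_sum, mul_sum]
    rw [sum_comm]
    refine sum_congr rfl fun h _ => sum_congr rfl fun x _ => ?_
    rw [div_eq_inv_mul]
    congr 2; ring
  rw [← Real.norm_eq_abs, ← Complex.norm_real, h1]
  refine (norm_sum_le _ _).trans ?_
  have h2 : ∀ h ∈ univ.filter (fun h : ZMod p => h ≠ 0), ‖(𝐞 (-h) - 1)⁻¹ *
      ∑ x ∈ Ico a b, 𝐞 (h * u * x + h * v * (x : ZMod p)⁻¹)‖
      ≤ 5 / 4 * p * (p : ℝ) ^ ((3 : ℝ) / 4) * (dz (-h) : ℝ)⁻¹ := by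
    intro h hh
    have hh0 : h ≠ 0 := (mem_filter.1 hh).2
    rw [norm_mul, norm_inv]
    calc _ ≤ (p / (4 * dz (-h)) : ℝ) * (5 * (p : ℝ) ^ ((3 : ℝ) / 4)) := by
          gcongr
          · exact inv_norm_sub_one_le (neg_ne_zero.2 hh0)
          · exact norm_incomplete_le _ (mul_ne_zero hh0 hv) ha hab hb
      _ = _ := by ring
  refine (sum_le_sum h2).trans ?_
  rw [← mul_sum]
  have h3 : ∑ h : ZMod p with h ≠ 0, (dz (-h) : ℝ)⁻¹ = ∑ h : ZMod p with h ≠ 0, (dz h : ℝ)⁻¹ :=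
    sum_bij' (fun k _ => -k) (fun k _ => -k) (by simp) (by simp) (by simp) (by simp) (by simp)
  have h4 := sum_dz_le (p := p) (fun n => (n : ℝ)⁻¹) (fun n => by positivity)
  have h5 : ∑ j ∈ Ico 1 p, (j : ℝ)⁻¹ ≤ 1 + Real.log p := by
    refine le_trans ?_ (harmonic_le_one_add_log p)
    rw [harmonic_eq_sum_Icc]
    push_cast
    refine sum_le_sum_of_subset_of_nonneg ?_ fun _ _ _ => by positivity
    intro j; simp only [mem_Ico, mem_Icc]; omega
  rw [h3]
  calc _ ≤ 5 / 4 * p * (p : ℝ) ^ ((3 : ℝ) / 4) * (2 * (1 + Real.log p)) := by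
        gcongr; linarith
    _ = _ := by ring

end

lemma modInv_mem_Ico {p x : ℕ} [Fact p.Prime] (h1 : 1 ≤ x) (h2 : x < p) :
    modInv p x ∈ Ico 1 p := by
  have hx : (x : ZMod p) ≠ 0 := by
    rw [Ne, ZMod.natCast_eq_zero_iff]
    exact Nat.not_dvd_of_pos_of_lt h1 h2
  exact mem_Ico.2 ⟨ZMod.val_pos.2 (inv_ne_zero hx), ZMod.val_lt _⟩

lemma mul_ite_mem_Bplus {p x : ℕ} [Fact p.Prime] (h1 : p < 3 * x) (h2 : 2 * x + 3 ≤ p) :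
    (p : ℝ) * (if x ∈ Bplus p then 1 else 0) = 3 * x
      - ((1 * x + 1 * (x : ZMod p)⁻¹ : ZMod p).val : ℝ)
      - ((2 * x + -1 * (x : ZMod p)⁻¹ : ZMod p).val : ℝ) := by
  obtain ⟨hy1, hy2⟩ := mem_Ico.1 (modInv_mem_Ico (p := p) (x := x) (by omega) (by omega))
  have hB : x ∈ Bplus p ↔ p ≤ x + modInv p x ∧ modInv p x ≤ 2 * x := by
    simp only [Bplus, mem_filter, mem_Icc]
    constructor
    · exact fun h => h.2.2
    · exact fun h => ⟨by omega, h2, h⟩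
  have hinv : (x : ZMod p)⁻¹ = (modInv p x : ZMod p) := by simp [modInv]
  generalize modInv p x = y at *
  have hr1 : (1 * x + 1 * (x : ZMod p)⁻¹ : ZMod p).val = if p ≤ x + y then x + y - p else x + y := by
    rw [hinv, one_mul, one_mul, ← Nat.cast_add, ZMod.val_natCast]
    split_ifs with h
    · rw [Nat.mod_eq_sub_mod h, Nat.mod_eq_of_lt (by omega)]
    · exact Nat.mod_eq_of_lt (by omega)
  have hr2 : (2 * x + -1 * (x : ZMod p)⁻¹ : ZMod p).val
      = if y ≤ 2 * x then 2 * x - y else 2 * x + p - y := by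
    have : (2 * x + -1 * (x : ZMod p)⁻¹ : ZMod p) = ((2 * x + p - y : ℕ) : ZMod p) := by
      rw [hinv, Nat.cast_sub (by omega)]; push_cast; simp [sub_eq_add_neg]
    rw [this, ZMod.val_natCast]
    split_ifs with h
    · rw [Nat.mod_eq_sub_mod (by omega), Nat.mod_eq_of_lt (by omega)]; omega
    · exact Nat.mod_eq_of_lt (by omega)
  rw [hr1, hr2]
  by_cases ha : p ≤ x + y <;> by_cases hb : y ≤ 2 * x
  · rw [if_pos (hB.2 ⟨ha, hb⟩), if_pos ha, if_pos hb, Nat.cast_sub ha, Nat.cast_sub hb]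
    push_cast; ring
  · rw [if_neg (fun h => hb (hB.1 h).2), if_pos ha, if_neg hb, Nat.cast_sub ha,
      Nat.cast_sub (by omega)]
    push_cast; ring
  · rw [if_neg (fun h => ha (hB.1 h).1), if_neg ha, if_pos hb, Nat.cast_sub hb]
    push_cast; ring
  · omega

lemma Bplus_subset_Ico {p : ℕ} [Fact p.Prime] (hp : 5 ≤ p) :
    Bplus p ⊆ Ico (p / 3 + 1) ((p - 1) / 2) := by
  intro x hx
  simp only [Bplus, mem_filter, mem_Icc] at hx
  have h3 : ¬ 3 ∣ p := fun h => by
    have := (Nat.prime_dvd_prime_iff_eq Nat.prime_three Fact.out).1 h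
    omega
  rw [mem_Ico]
  omega

lemma sum_Ico_linear (a n : ℕ) (c : ℝ) :
    ∑ x ∈ Ico a (a + n), (3 * (x : ℝ) - c) = n * (3 * a - c) + 3 * (n * (n - 1)) / 2 := by
  induction n with
  | zero => simp
  | succ n ih => rw [← add_assoc, sum_Ico_succ_top (by omega), ih]; push_cast; ring

lemma abs_main_term_sub_le {p : ℕ} (hp : p.Prime) (hp5 : 5 ≤ p) :
    |∑ x ∈ Ico (p / 3 + 1) ((p - 1) / 2), (3 * (x : ℝ) - (p - 1)) - p * (p / 24 : ℝ)| ≤ p := by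
  have h2 : p % 2 = 1 := hp.eq_two_or_odd.resolve_left (by omega)
  have h3 : p % 3 ≠ 0 := fun h => by
    have := (Nat.prime_dvd_prime_iff_eq Nat.prime_three hp).1 (Nat.dvd_of_mod_eq_zero h)
    omega
  obtain ⟨m, hm | hm⟩ : ∃ m, p = 6 * (m + 1) + 1 ∨ p = 6 * m + 5 := by
    rcases (by omega : p % 6 = 1 ∨ p % 6 = 5) with h | h
    · exact ⟨p / 6 - 1, by omega⟩
    · exact ⟨p / 6, by omega⟩
  · rw [show p / 3 + 1 = 2 * m + 3 by omega, show (p - 1) / 2 = 2 * m + 3 + m by omega,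
      sum_Ico_linear, hm, abs_le]
    push_cast
    have := Nat.cast_nonneg (α := ℝ) m
    constructor <;> nlinarith
  · rw [show p / 3 + 1 = 2 * m + 2 by omega, show (p - 1) / 2 = 2 * m + 2 + m by omega,
      sum_Ico_linear, hm, abs_le]
    push_cast
    have := Nat.cast_nonneg (α := ℝ) m
    constructor <;> nlinarith

lemma abs_card_Bplus_sub_le {p : ℕ} (hp : p.Prime) (hp5 : 5 ≤ p) :
    |((Bplus p).card : ℝ) - (p : ℝ) / 24|
      ≤ 1 + 5 * (p : ℝ) ^ ((3 : ℝ) / 4) * (1 + Real.log p) := by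
  have : Fact p.Prime := ⟨hp⟩
  have hp0 : (0 : ℝ) < p := by exact_mod_cast hp.pos
  set J := Ico (p / 3 + 1) ((p - 1) / 2) with hJ
  have hcard : (p : ℝ) * (Bplus p).card
      = ∑ x ∈ J, (3 * (x : ℝ) - (p - 1))
        - ∑ x ∈ J, (((1 * x + 1 * (x : ZMod p)⁻¹ : ZMod p).val : ℝ) - (p - 1) / 2)
        - ∑ x ∈ J, (((2 * x + -1 * (x : ZMod p)⁻¹ : ZMod p).val : ℝ) - (p - 1) / 2) := by
    have h1 : ((Bplus p).card : ℝ) = ∑ x ∈ J, if x ∈ Bplus p then 1 else 0 := by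
      rw [sum_boole, filter_mem_eq_inter, inter_eq_right.2 (Bplus_subset_Ico hp5)]
    rw [h1, mul_sum, ← sum_sub_distrib, ← sum_sub_distrib]
    refine sum_congr rfl fun x hx => ?_
    rw [hJ, mem_Ico] at hx
    rw [mul_ite_mem_Bplus (by omega) (by omega)]
    ring
  have hab : p / 3 + 1 ≤ (p - 1) / 2 := by
    have h2 : p % 2 = 1 := hp.eq_two_or_odd.resolve_left (by omega)
    omega
  have h1 := abs_sum_val_sub_le (p := p) 1 1 one_ne_zero (a := p / 3 + 1) (b := (p - 1) / 2)
    (by omega) hab (by omega)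
  have h2 := abs_sum_val_sub_le (p := p) 2 (-1) (neg_ne_zero.2 one_ne_zero) (a := p / 3 + 1)
    (b := (p - 1) / 2) (by omega) hab (by omega)
  have h3 := abs_main_term_sub_le hp hp5
  rw [← hJ] at h1 h2 h3
  refine le_of_mul_le_mul_left ?_ hp0
  rw [← abs_of_pos hp0, ← abs_mul, abs_of_pos hp0, mul_sub, hcard]
  rw [abs_le] at *
  constructor <;> linarith [h1.1, h1.2, h2.1, h2.2, h3.1, h3.2]

theorem stmt_7 (p : ℕ) (hp : p.Prime) :
    |((Bplus p).card : ℝ) - (p : ℝ) / 24| ≤ 12 * (p : ℝ) ^ ((3 : ℝ) / 4) * Real.log p := by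
  have hp1 : (1 : ℝ) ≤ p := by exact_mod_cast hp.one_le
  have hq : 1 ≤ (p : ℝ) ^ ((3 : ℝ) / 4) := Real.one_le_rpow hp1 (by norm_num)
  rcases lt_or_ge p 5 with h | h
  · have hB : Bplus p = ∅ := by
      refine filter_eq_empty_iff.2 fun x hx => ?_
      rw [mem_Icc] at hx
      have : p ≠ 4 := by rintro rfl; norm_num at hp
      omega
    have h2 : (2 : ℝ) ≤ p := by exact_mod_cast hp.two_le
    have h5 : (p : ℝ) < 5 := by exact_mod_cast h
    have hlog : 0.6931471803 < Real.log p :=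
      Real.log_two_gt_d9.trans_le (Real.log_le_log (by norm_num) h2)
    rw [hB, card_empty, Nat.cast_zero, zero_sub, abs_neg, abs_of_nonneg (by positivity)]
    nlinarith
  · have h5 : (5 : ℝ) ≤ p := by exact_mod_cast h
    have hlog : 1 ≤ Real.log p := by
      rw [Real.le_log_iff_exp_le (by linarith)]
      linarith [Real.exp_one_lt_d9]
    refine (abs_card_Bplus_sub_le hp h).trans ?_
    nlinarith [mul_le_mul_of_nonneg_left hlog (zero_le_one.trans hq)]
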